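/- arXiv:1808.10612 — 2 statements merged into one kernel-verified Lean document; each statement's English description precedes it below -/
import Mathlib

section
/- Let 0 < ρ ≤ 1/2 and let μ be a shift-invariant, ergodic probability measure on {0,1}^ℤ with density ρ. Assume that μ assigns zero probability to every occurrence of the pattern 11(01)^k 00: for every integer k ≥ 0 and every x ∈ ℤ, μ{η : η(x) = η(x+1) = 1, η(x+2+2l) = 0 and η(x+3+2l) = 1 for all 0 ≤ l < k, and η(x+2k+2) = η(x+2k+3) = 0} = 0. Then μ is degenerate: μ{η : η(x) = η(x+1) = 1} = 0 for all x ∈ ℤ. -/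
open MeasureTheory Filter

/-- The shift transformation on configurations `{0,1}^ℤ`: `(shift x η) y = η (x + y)`. -/
def shift (x : ℤ) (η : ℤ → Bool) : ℤ → Bool := fun y => η (x + y)

lemma measurable_shift (x : ℤ) : Measurable (shift x) :=
  measurable_pi_lambda _ fun y => measurable_pi_apply (x + y)

lemma measurableSet_apply_eq (y : ℤ) (b : Bool) : MeasurableSet {η : ℤ → Bool | η y = b} :=
  measurableSet_eq_fun (measurable_pi_apply y) measurable_const

/-- The configurations with two adjacent zeros somewhere to the right of `n`. -/
def zerosFrom (n : ℤ) : Set (ℤ → Bool) := {η | ∃ y, n ≤ y ∧ η y = false ∧ η (y + 1) = false}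

lemma measurableSet_zerosFrom (n : ℤ) : MeasurableSet (zerosFrom n) := by
  have h : zerosFrom n =
      ⋃ y : ℤ, ⋃ _ : n ≤ y, ({η | η y = false} ∩ {η | η (y + 1) = false}) := by
    ext η; simp [zerosFrom, and_left_comm]
  rw [h]
  exact .iUnion fun y => .iUnion fun _ =>
    (measurableSet_apply_eq y false).inter (measurableSet_apply_eq (y + 1) false)

lemma zerosFrom_antitone : Antitone zerosFrom :=
  fun _ _ h _ ⟨y, hy, hη⟩ => ⟨y, h.trans hy, hη⟩

lemma shift_preimage_zerosFrom (x n : ℤ) : shift x ⁻¹' zerosFrom n = zerosFrom (x + n) := by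
  ext η
  constructor
  · rintro ⟨y, hy, h⟩
    exact ⟨x + y, by lia, by simpa [shift, add_assoc] using h⟩
  · rintro ⟨y, hy, h⟩
    refine ⟨y - x, by lia, ?_⟩
    have e : x + (y - x + 1) = y + 1 := by ring
    simpa [shift, e] using h

/-- The pattern `11(01)^k` occurs at `x`. -/
def OnesThenAlternating (η : ℤ → Bool) (x : ℤ) (k : ℕ) : Prop :=
  η x = true ∧ η (x + 1) = true ∧
    ∀ l : ℕ, l < k → η (x + 2 + 2 * l) = false ∧ η (x + 3 + 2 * l) = true

lemma OnesThenAlternating.apply_end {η : ℤ → Bool} {x : ℤ} {k : ℕ}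
    (h : OnesThenAlternating η x k) : η (x + 2 * k + 1) = true := by
  cases k with
  | zero => simpa using h.2.1
  | succ k =>
    have := (h.2.2 k (by lia)).2
    rwa [show x + 3 + 2 * (k : ℤ) = x + 2 * ((k + 1 : ℕ) : ℤ) + 1 by push_cast; ring] at this

/-- If no pattern `11(01)^k 00` occurs, then after `11` the configuration can always be parsed
as ending in `11(01)^k` or `11(01)^k 0`. -/
lemma exists_onesThenAlternating {η : ℤ → Bool}
    (hη : ∀ x k, OnesThenAlternating η x k →
      ¬ (η (x + 2 * k + 2) = false ∧ η (x + 2 * k + 3) = false))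
    {x : ℤ} (h0 : η x = true) (h1 : η (x + 1) = true) (n : ℕ) :
    ∃ z k, OnesThenAlternating η z k ∧ (z + 2 * k + 1 = x + 1 + n ∨
      z + 2 * k + 2 = x + 1 + n ∧ η (x + 1 + n) = false) := by
  induction n with
  | zero => exact ⟨x, 0, ⟨h0, h1, by simp⟩, .inl (by simp)⟩
  | succ n ih =>
    obtain ⟨z, k, hz, h | ⟨h, hf⟩⟩ := ih
    · cases hb : η (x + 1 + (n + 1 : ℕ)) with
      | false => exact ⟨z, k, hz, .inr ⟨by push_cast; lia, rfl⟩⟩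
      | true =>
        refine ⟨x + 1 + n, 0, ⟨h ▸ hz.apply_end, ?_, by simp⟩, .inl (by push_cast; lia)⟩
        rw [← hb]; push_cast; ring_nf
    · refine ⟨z, k + 1, ⟨hz.1, hz.2.1, fun l hl => ?_⟩, .inl (by push_cast; lia)⟩
      rcases Nat.lt_succ_iff_lt_or_eq.mp hl with hl | rfl
      · exact hz.2.2 l hl
      · have e2 : z + 2 + 2 * (l : ℤ) = z + 2 * l + 2 := by ring
        have e3 : z + 3 + 2 * (l : ℤ) = z + 2 * l + 3 := by ring
        have h2 : η (z + 2 * l + 2) = false := h ▸ hf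
        rw [e2, e3]
        exact ⟨h2, by simpa [h2] using hη z l hz⟩

lemma exists_pattern {η : ℤ → Bool} {x : ℤ} (h0 : η x = true) (h1 : η (x + 1) = true)
    (hz : η ∈ zerosFrom x) : ∃ z k, OnesThenAlternating η z k ∧
      η (z + 2 * k + 2) = false ∧ η (z + 2 * k + 3) = false := by
  by_contra! hη
  have hη' : ∀ x k, OnesThenAlternating η x k →
      ¬ (η (x + 2 * k + 2) = false ∧ η (x + 2 * k + 3) = false) :=
    fun x k h h' => hη x k h h'.1 h'.2
  obtain ⟨y, hy, hy0, hy1⟩ := hz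
  have hne : y ≠ x := by rintro rfl; simp [h0] at hy0
  obtain ⟨n, hn⟩ := Int.eq_ofNat_of_zero_le (show 0 ≤ y - (x + 1) by lia)
  obtain rfl : y = x + 1 + n := by lia
  obtain ⟨z, k, h, e | ⟨e, -⟩⟩ := exists_onesThenAlternating hη' h0 h1 n
  · have := h.apply_end
    rw [e, hy0] at this
    exact absurd this (by simp)
  · refine hη' z k h ⟨e ▸ hy0, ?_⟩
    rwa [show z + 2 * (k : ℤ) + 3 = x + 1 + n + 1 by lia]

/-- If a shift-invariant ergodic probability measure on `{0,1}^ℤ` with density `0 < ρ ≤ 1/2`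
assigns zero probability to every pattern `11(01)^k 00`, then it is degenerate:
it gives zero probability to adjacent ones. -/
theorem degenerate_of_no_pattern (ρ : ℝ) (h1 : 0 < ρ) (h2 : ρ ≤ 1 / 2)
    (μ : Measure (ℤ → Bool)) [IsProbabilityMeasure μ]
    (hinv : ∀ x : ℤ, μ.map (shift x) = μ)
    (herg : ∀ A : Set (ℤ → Bool), MeasurableSet A →
      (∀ x : ℤ, μ (symmDiff A (shift x ⁻¹' A)) = 0) → μ A = 0 ∨ μ A = 1)
    (hdens : ∀ x : ℤ, μ {η | η x = true} = ENNReal.ofReal ρ)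
    (hpattern : ∀ (k : ℕ) (x : ℤ),
      μ {η | η x = true ∧ η (x + 1) = true ∧
        (∀ l : ℕ, l < k → η (x + 2 + 2 * l) = false ∧ η (x + 3 + 2 * l) = true) ∧
        η (x + 2 * k + 2) = false ∧ η (x + 2 * k + 3) = false} = 0) :
    ∀ x : ℤ, μ {η | η x = true ∧ η (x + 1) = true} = 0 := by
 
  have hmeas (n : ℤ) : μ (zerosFrom n) = μ (zerosFrom 0) := by
    conv_rhs => rw [← hinv n]
    rw [Measure.map_apply (measurable_shift n) (measurableSet_zerosFrom 0),
      shift_preimage_zerosFrom, add_zero]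
  have hsymm (x : ℤ) : μ (symmDiff (zerosFrom 0) (shift x ⁻¹' zerosFrom 0)) = 0 := by
    rw [shift_preimage_zerosFrom, add_zero, measure_symmDiff_eq_zero_iff]
    rcases le_total 0 x with h | h
    · exact (ae_eq_of_subset_of_measure_ge (zerosFrom_antitone h) (hmeas x).ge
        (measurableSet_zerosFrom x).nullMeasurableSet (measure_ne_top _ _)).symm
    · exact ae_eq_of_subset_of_measure_ge (zerosFrom_antitone h) (hmeas x).le
        (measurableSet_zerosFrom 0).nullMeasurableSet (measure_ne_top _ _)
  intro x
  rcases herg _ (measurableSet_zerosFrom 0) hsymm with h | h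
  · have hsub : {η : ℤ → Bool | η (x + 1) = false} ⊆
        {η | η x = true} \ {η | η (x + 1) = true} ∪ zerosFrom x := by
      intro η (hη : η (x + 1) = false)
      cases hx : η x with
      | true => exact .inl ⟨hx, by simp [hη]⟩
      | false => exact .inr ⟨x, le_rfl, hx, hη⟩
    have hzero : μ.real (zerosFrom x) = 0 := by simp [measureReal_def, hmeas, h]
    have hone (y : ℤ) : μ.real {η | η y = true} = ρ := by
      rw [measureReal_def, hdens, ENNReal.toReal_ofReal h1.le]
    have hle := (measureReal_mono (μ := μ) hsub).trans (measureReal_union_le _ _)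
    have hcompl : μ.real {η : ℤ → Bool | η (x + 1) = false} = 1 - ρ := by
      rw [← hone (x + 1), ← probReal_compl_eq_one_sub (measurableSet_apply_eq (x + 1) true)]
      congr 1; ext η; simp
    have hsplit := measureReal_inter_add_sdiff (μ := μ) (s := {η : ℤ → Bool | η x = true})
      (measurableSet_apply_eq (x + 1) true)
    rw [hone] at hsplit
    have hnonneg : 0 ≤ μ.real ({η : ℤ → Bool | η x = true} ∩ {η | η (x + 1) = true}) :=
      measureReal_nonneg
    exact (measureReal_eq_zero_iff (μ := μ)).mp
      (show μ.real ({η : ℤ → Bool | η x = true} ∩ {η | η (x + 1) = true}) = 0 by linarith)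
  · have hx : ∀ᵐ η ∂μ, η ∈ zerosFrom x :=
      (mem_ae_iff_prob_eq_one (measurableSet_zerosFrom x)).mpr ((hmeas x).trans h)
    have hpat : ∀ᵐ η ∂μ, ∀ (k : ℕ) (z : ℤ), ¬ (η z = true ∧ η (z + 1) = true ∧
        (∀ l : ℕ, l < k → η (z + 2 + 2 * l) = false ∧ η (z + 3 + 2 * l) = true) ∧
        η (z + 2 * k + 2) = false ∧ η (z + 2 * k + 3) = false) :=
      ae_all_iff.mpr fun k => ae_all_iff.mpr fun z => measure_eq_zero_iff_ae_notMem.mp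
        (hpattern k z)
    refine measure_eq_zero_iff_ae_notMem.mpr ?_
    filter_upwards [hx, hpat] with η hη hno ⟨h0, h1'⟩
    obtain ⟨z, k, ⟨ha, hb, hc⟩, hd⟩ := exists_pattern h0 h1' hη
    exact hno k z ⟨ha, hb, hc, hd⟩
end

section
/- Let η : ℤ → {0,1} be a configuration with η(0) = η(1) = 1, and suppose m ≥ 3 is the minimal integer m ≥ 1 such that η(m−1) = η(m) = 0. Then η contains an occurrence of the pattern 11(01)^k 00 within [0, m]: there exist integers i ≥ 0 and k ≥ 0 with i + 2k + 3 ≤ m, such that η(i) = η(i+1) = 1, η(i+2+2l) = 0 and η(i+3+2l) = 1 for all 0 ≤ l < k, and η(i+2k+2) = η(i+2k+3) = 0. -/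
/-- If `(01)^k 00` starts at a position `2 ≤ j` and `η` has no double zero among the positions
`0, …, j`, then extending the block to the left reaches a double one. -/
theorem exists_double_one_before_block (η : ℤ → Bool) (h0 : η 0 = true) (h1 : η 1 = true)
    (n : ℕ) (j : ℤ) (k : ℕ) (hjn : j ≤ n) (hj : 2 ≤ j)
    (hmin : ∀ p : ℤ, 1 ≤ p → p ≤ j → ¬(η (p - 1) = false ∧ η p = false))
    (hz : η j = false)
    (hblock : ∀ l : ℕ, l < k → η (j + 2 * l) = false ∧ η (j + 1 + 2 * l) = true)
    (hend : η (j + 2 * k) = false ∧ η (j + 2 * k + 1) = false) :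
    ∃ (i : ℤ) (k' : ℕ), 0 ≤ i ∧ i + 2 * k' + 3 = j + 2 * k + 1 ∧
      η i = true ∧ η (i + 1) = true ∧
      (∀ l : ℕ, l < k' → η (i + 2 + 2 * l) = false ∧ η (i + 3 + 2 * l) = true) ∧
      η (i + 2 * k' + 2) = false ∧ η (i + 2 * k' + 3) = false := by
  induction n generalizing j k with
  | zero => push_cast at hjn; omega
  | succ n ih =>
    have hone : η (j - 1) = true := by
      by_contra h
      exact hmin j (by omega) le_rfl ⟨by simpa using h, hz⟩
    by_cases htwo : η (j - 2) = true
    · refine ⟨j - 2, k, by omega, by ring, htwo, ?_, fun l hl => ?_, ?_, ?_⟩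
      · rw [← hone]; congr 1; ring
      · obtain ⟨ha, hb⟩ := hblock l hl
        constructor
        · rw [← ha]; congr 1; ring
        · rw [← hb]; congr 1; ring
      · rw [← hend.1]; congr 1; ring
      · rw [← hend.2]; congr 1; ring
    · have hj2 : j ≠ 2 := by rintro rfl; exact htwo (by simpa using h0)
      have hj3 : j ≠ 3 := by rintro rfl; exact htwo (by simpa using h1)
      obtain ⟨i, k', hi, hlen, hrest⟩ := ih (j - 2) (k + 1) (by push_cast at hjn; omega) (by omega)
        (fun p hp hpj => hmin p hp (by omega)) (by simpa using htwo)
        (fun l hl => by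
          cases l with
          | zero =>
            refine ⟨by simpa using htwo, ?_⟩
            rw [← hone]; congr 1; push_cast; ring
          | succ l =>
            obtain ⟨ha, hb⟩ := hblock l (by omega)
            constructor
            · rw [← ha]; congr 1; push_cast; ring
            · rw [← hb]; congr 1; push_cast; ring)
        (by
          constructor
          · rw [← hend.1]; congr 1; push_cast; ring
          · rw [← hend.2]; congr 1; push_cast; ring)
      exact ⟨i, k', hi, by push_cast at hlen; omega, hrest⟩

/-- If `η(0) = η(1) = 1` and `m ≥ 3` is the minimal integer `m ≥ 1` with
`η(m-1) = η(m) = 0`, then `η` contains an occurrence of the pattern `11(01)^k 00`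
within `[0, m]`. -/
theorem pattern_exists_before_first_double_zero (η : ℤ → Bool) (m : ℤ)
    (h0 : η 0 = true) (h1 : η 1 = true) (hm3 : 3 ≤ m)
    (hm : η (m - 1) = false ∧ η m = false)
    (hmin : ∀ m' : ℤ, 1 ≤ m' → m' < m → ¬(η (m' - 1) = false ∧ η m' = false)) :
    ∃ (i : ℤ) (k : ℕ), 0 ≤ i ∧ i + 2 * k + 3 ≤ m ∧
      η i = true ∧ η (i + 1) = true ∧
      (∀ l : ℕ, l < k → η (i + 2 + 2 * l) = false ∧ η (i + 3 + 2 * l) = true) ∧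
      η (i + 2 * k + 2) = false ∧ η (i + 2 * k + 3) = false := by
  obtain ⟨i, k, hi, hlen, hrest⟩ := exists_double_one_before_block η h0 h1 (m - 1).toNat (m - 1) 0
    (by omega) (by omega) (fun p hp hpm => hmin p hp (by omega)) hm.1
    (fun l hl => absurd hl (Nat.not_lt_zero l)) (by simpa using hm)
  exact ⟨i, k, hi, by push_cast at hlen; omega, hrest⟩
end
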